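/- arXiv:0806.1587 — 8 statements merged into one kernel-verified Lean document; each statement's English description precedes it below -/
import Mathlib

section
/- An opinion profile x is an HK fixed point for the bound of confidence ε > 0 if and only if for all agents i, j one has ‖x i − x j‖ > ε or x i = x j. -/
open Finset
open scoped Classical

/-- The confidence set `I(i,x)` of agent `i` in profile `x`:
all agents `j` with `‖x i - x j‖ ≤ ε`. -/
noncomputable def confSet {n d : ℕ} (ε : ℝ) (x : Fin n → EuclideanSpace ℝ (Fin d))
    (i : Fin n) : Finset (Fin n) :=
  Finset.univ.filter (fun j => ‖x i - x j‖ ≤ ε)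

/-- The Hegselmann–Krause update of the profile `x` at agent `i`. -/
noncomputable def hkUpdate {n d : ℕ} (ε : ℝ) (x : Fin n → EuclideanSpace ℝ (Fin d))
    (i : Fin n) : EuclideanSpace ℝ (Fin d) :=
  (1 / ((confSet ε x i).card : ℝ)) • ∑ j ∈ confSet ε x i, x j

/-- `x` is a fixed point of the HK model. -/
def HKFixed {n d : ℕ} (ε : ℝ) (x : Fin n → EuclideanSpace ℝ (Fin d)) : Prop :=
  ∀ i, hkUpdate ε x i = x i

/-- `x` is an HK fixed point iff any two agents either are farther
apart than `ε` or hold the same opinion. -/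
theorem hk_fixed_point_iff (n d : ℕ) (hn : 1 ≤ n) (hd : 1 ≤ d)
    (ε : ℝ) (hε : 0 < ε) (x : Fin n → EuclideanSpace ℝ (Fin d)) :
    HKFixed ε x ↔ ∀ i j : Fin n, ε < ‖x i - x j‖ ∨ x i = x j := by
  have key : HKFixed ε x ↔ ∀ i, ∑ j ∈ confSet ε x i, (x j - x i) = 0 := by
    unfold HKFixed hkUpdate
    refine forall_congr' fun i => ?_
    have hmem : i ∈ confSet ε x i := by
      simp [confSet, hε.le]
    have hc : ((confSet ε x i).card : ℝ) ≠ 0 := by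
      have := Finset.card_pos.mpr ⟨i, hmem⟩
      positivity
    rw [Finset.sum_sub_distrib, Finset.sum_const, sub_eq_zero, one_div,
      inv_smul_eq_iff₀ hc, Nat.cast_smul_eq_nsmul]
  rw [key]
  constructor
  · intro h
    have h1 : ∑ i, ∑ j, (if ‖x i - x j‖ ≤ ε then inner ℝ (x j - x i) (x i) else 0) = 0 := by
      refine Finset.sum_eq_zero fun i _ => ?_
      rw [← Finset.sum_filter, ← sum_inner]
      have := h i
      unfold confSet at this
      rw [this, inner_zero_left]
    have h2 : ∑ i, ∑ j, (if ‖x i - x j‖ ≤ ε then inner ℝ (x i - x j) (x j) else 0) = 0 := by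
      rw [Finset.sum_comm]
      refine Eq.trans ?_ h1
      refine Finset.sum_congr rfl fun i _ => Finset.sum_congr rfl fun j _ => ?_
      rw [norm_sub_rev]
    have h3 : ∑ i, ∑ j, (if ‖x i - x j‖ ≤ ε then ‖x i - x j‖ ^ 2 else 0) = 0 := by
      have h4 : ∑ i, ∑ j, (if ‖x i - x j‖ ≤ ε then ‖x i - x j‖ ^ 2 else 0)
          = -(∑ i, ∑ j, (if ‖x i - x j‖ ≤ ε then inner ℝ (x j - x i) (x i) else 0)
            + ∑ i, ∑ j, (if ‖x i - x j‖ ≤ ε then inner ℝ (x i - x j) (x j) else 0)) := by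
        simp only [← Finset.sum_add_distrib, ← Finset.sum_neg_distrib]
        refine Finset.sum_congr rfl fun i _ => Finset.sum_congr rfl fun j _ => ?_
        split_ifs
        · rw [← real_inner_self_eq_norm_sq]
          simp only [inner_sub_left, inner_sub_right]
          rw [real_inner_comm (x i) (x j)]
          ring
        · simp
      rw [h4, h1, h2]; simp
    have hnn : ∀ i j, 0 ≤ (if ‖x i - x j‖ ≤ ε then ‖x i - x j‖ ^ 2 else 0) := by
      intro i j
      split_ifs <;> positivity
    intro i j
    rw [Finset.sum_eq_zero_iff_of_nonneg
      (fun i _ => Finset.sum_nonneg fun j _ => hnn i j)] at h3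
    have h5 := (Finset.sum_eq_zero_iff_of_nonneg (fun j _ => hnn i j)).mp
      (h3 i (Finset.mem_univ i)) j (Finset.mem_univ j)
    rcases lt_or_ge ε ‖x i - x j‖ with hl | hl
    · exact Or.inl hl
    · right
      rw [if_pos hl] at h5
      exact sub_eq_zero.mp (norm_eq_zero.mp (pow_eq_zero_iff (two_ne_zero)|>.mp h5))
  · intro h i
    refine Finset.sum_eq_zero fun j hj => ?_
    have hj' : ‖x i - x j‖ ≤ ε := by simpa [confSet] using hj
    rcases h i j with hl | hl
    · exact absurd hl (not_lt.mpr hj')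
    · rw [hl, sub_self]
end

section
/- An opinion distribution p is a fixed point of the DW interactive Markov chain, i.e. (pB^DW(p,ε)) k = p k for all k ∈ {1,…,n}, if and only if for all k ∈ {1,…,n}: p k > 0 implies p m = 0 for every m ∈ {1,…,n} with 2 ≤ |m − k| ≤ ε. -/
open Finset
open scoped Classical

/-- `p : ℤ → ℝ` is an opinion distribution on the classes `{1,…,n}`:
nonnegative, vanishing outside `{1,…,n}`, summing to `1`. -/
def IsDist (n : ℤ) (p : ℤ → ℝ) : Prop :=
  (∀ m, 0 ≤ p m) ∧ (∀ m, m ∉ Finset.Icc (1:ℤ) n → p m = 0) ∧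
    (∑ k ∈ Finset.Icc (1:ℤ) n, p k) = 1

/-- `π^i m = p m` if `|i - m| ≤ ε`, else `0`. -/
noncomputable def piF (p : ℤ → ℝ) (ε i m : ℤ) : ℝ :=
  if |i - m| ≤ ε then p m else 0

/-- Off-diagonal entry of the Deffuant–Weisbuch transition matrix. -/
noncomputable def BDWoff (p : ℤ → ℝ) (ε i j : ℤ) : ℝ :=
  piF p ε i (2*j - i - 1) / 2 + piF p ε i (2*j - i) + piF p ε i (2*j - i + 1) / 2

/-- The Deffuant–Weisbuch transition matrix `B^DW(p,ε)` on `{1,…,n} × {1,…,n}`. -/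
noncomputable def BDW (n : ℤ) (p : ℤ → ℝ) (ε i j : ℤ) : ℝ :=
  if i = j then 1 - ∑ j' ∈ (Finset.Icc (1:ℤ) n).erase i, BDWoff p ε i j'
  else BDWoff p ε i j

/-- One step of the DW interactive Markov chain: `(pB^DW(p,ε)) k`. -/
noncomputable def stepDW (n : ℤ) (p : ℤ → ℝ) (ε : ℤ) (k : ℤ) : ℝ :=
  ∑ i ∈ Finset.Icc (1:ℤ) n, p i * BDW n p ε i k

noncomputable def wDW (i j m : ℤ) : ℝ :=
  (if j = (i + m) / 2 then 1/2 else 0) + (if j = (i + m + 1) / 2 then 1/2 else 0)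

lemma wDW_eq (i j m : ℤ) : wDW i j m =
    (if m = 2*j - i - 1 then 1/2 else 0) + (if m = 2*j - i then 1 else 0)
      + (if m = 2*j - i + 1 then 1/2 else 0) := by
  unfold wDW
  split_ifs <;> first | (exfalso; omega) | norm_num

lemma piF_out (n ε : ℤ) (p : ℤ → ℝ) (hp : IsDist n p) (i a : ℤ) (c : ℝ) :
    ∑ m ∈ Finset.Icc (1:ℤ) n, piF p ε i m * (if m = a then c else 0) = piF p ε i a * c := by
  simp only [mul_ite, mul_zero, Finset.sum_ite_eq']
  split_ifs with h
  · rfl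
  · simp [piF, hp.2.1 a h]

lemma off_eq (n ε : ℤ) (p : ℤ → ℝ) (hp : IsDist n p) (i j : ℤ) :
    BDWoff p ε i j = ∑ m ∈ Finset.Icc (1:ℤ) n, piF p ε i m * wDW i j m := by
  simp only [wDW_eq, mul_add, Finset.sum_add_distrib, piF_out n ε p hp]
  unfold BDWoff
  ring

lemma step_sub (n ε : ℤ) (p f : ℤ → ℝ) :
    ∑ k ∈ Finset.Icc (1:ℤ) n, f k * (stepDW n p ε k - p k) =
    ∑ i ∈ Finset.Icc (1:ℤ) n, p i *
      ∑ j ∈ Finset.Icc (1:ℤ) n, BDWoff p ε i j * (f j - f i) := by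
  have h1 : ∀ i ∈ Finset.Icc (1:ℤ) n, ∑ k ∈ Finset.Icc (1:ℤ) n, f k * BDW n p ε i k
      = f i + ∑ j ∈ Finset.Icc (1:ℤ) n, BDWoff p ε i j * (f j - f i) := by
    intro i hi
    rw [← Finset.add_sum_erase _ _ hi, ← Finset.add_sum_erase _ (fun j => BDWoff p ε i j * (f j - f i)) hi]
    have h2 : ∑ x ∈ (Finset.Icc (1:ℤ) n).erase i, f x * BDW n p ε i x
        = ∑ x ∈ (Finset.Icc (1:ℤ) n).erase i, f x * BDWoff p ε i x := by
      refine Finset.sum_congr rfl fun x hx => ?_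
      rw [BDW, if_neg (Finset.ne_of_mem_erase hx).symm]
    rw [h2, BDW, if_pos rfl]
    simp only [mul_sub, Finset.sum_sub_distrib, ← Finset.sum_mul, sub_self, zero_add]
    simp only [mul_comm (f _)]
    ring
  simp only [mul_sub, Finset.sum_sub_distrib, stepDW, Finset.mul_sum]
  rw [Finset.sum_comm, ← Finset.sum_sub_distrib, ← Finset.sum_sub_distrib]
  refine Finset.sum_congr rfl fun i hi => ?_
  have := h1 i hi
  have h3 : ∑ k ∈ Finset.Icc (1:ℤ) n, f k * (p i * BDW n p ε i k)
      = p i * ∑ k ∈ Finset.Icc (1:ℤ) n, f k * BDW n p ε i k := by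
    rw [Finset.mul_sum]; exact Finset.sum_congr rfl fun _ _ => by ring
  rw [h3, this, mul_add]
  simp only [mul_sub, Finset.sum_sub_distrib, Finset.mul_sum]
  ring

lemma wsum (n i m : ℤ) (f : ℤ → ℝ) (hi : i ∈ Finset.Icc (1:ℤ) n) (hm : m ∈ Finset.Icc (1:ℤ) n) :
    2 * ∑ j ∈ Finset.Icc (1:ℤ) n, wDW i j m * (f j - f i)
      = f ((i+m)/2) + f ((i+m+1)/2) - 2 * f i := by
  rw [Finset.mem_Icc] at hi hm
  by_cases him : i = m
  · subst him
    have e1 : (i+i)/2 = i := by omega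
    have e2 : (i+i+1)/2 = i := by omega
    simp only [wDW, add_mul, ite_mul, zero_mul, Finset.sum_add_distrib, Finset.sum_ite_eq', e1, e2]
    simp
    ring
  · have e1 : (i+m)/2 ∈ Finset.Icc (1:ℤ) n := by rw [Finset.mem_Icc]; omega
    have e2 : (i+m+1)/2 ∈ Finset.Icc (1:ℤ) n := by rw [Finset.mem_Icc]; omega
    simp only [wDW, add_mul, ite_mul, zero_mul, Finset.sum_add_distrib, Finset.sum_ite_eq', e1, e2,
      if_true]
    ring

lemma main_id (n ε : ℤ) (p f : ℤ → ℝ) (hp : IsDist n p) :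
    4 * ∑ k ∈ Finset.Icc (1:ℤ) n, f k * (stepDW n p ε k - p k) =
    ∑ i ∈ Finset.Icc (1:ℤ) n, ∑ m ∈ Finset.Icc (1:ℤ) n, p i * piF p ε i m *
      (2 * (f ((i+m)/2) + f ((i+m+1)/2) - f i - f m)) := by
  have h1 : 2 * ∑ k ∈ Finset.Icc (1:ℤ) n, f k * (stepDW n p ε k - p k) =
    ∑ i ∈ Finset.Icc (1:ℤ) n, ∑ m ∈ Finset.Icc (1:ℤ) n, p i * piF p ε i m *
      (f ((i+m)/2) + f ((i+m+1)/2) - 2 * f i) := by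
    rw [step_sub, Finset.mul_sum]
    refine Finset.sum_congr rfl fun i hi => ?_
    simp only [off_eq n ε p hp, Finset.sum_mul]
    rw [Finset.sum_comm, Finset.mul_sum, Finset.mul_sum]
    refine Finset.sum_congr rfl fun m hm => ?_
    rw [← wsum n i m f hi hm]
    simp only [mul_assoc, ← Finset.mul_sum]
    ring
  have h2 := h1
  rw [Finset.sum_comm] at h2
  have h3 : 4 * ∑ k ∈ Finset.Icc (1:ℤ) n, f k * (stepDW n p ε k - p k) =
    2 * ∑ k ∈ Finset.Icc (1:ℤ) n, f k * (stepDW n p ε k - p k) +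
    2 * ∑ k ∈ Finset.Icc (1:ℤ) n, f k * (stepDW n p ε k - p k) := by ring
  rw [h3]
  nth_rewrite 1 [h1]
  rw [h2]
  simp only [← Finset.sum_add_distrib]
  refine Finset.sum_congr rfl fun i hi => Finset.sum_congr rfl fun m hm => ?_
  have hs : p m * piF p ε m i = p i * piF p ε i m := by
    unfold piF
    rw [abs_sub_comm m i]
    split_ifs <;> ring
  rw [hs, add_comm m i]
  ring

lemma sqDW_le (i m : ℤ) : (((i+m)/2 : ℤ) : ℝ)^2 + (((i+m+1)/2 : ℤ) : ℝ)^2 - (i:ℝ)^2 - (m:ℝ)^2 ≤ 0 ∧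
    (2 ≤ |m - i| →
      (((i+m)/2 : ℤ) : ℝ)^2 + (((i+m+1)/2 : ℤ) : ℝ)^2 - (i:ℝ)^2 - (m:ℝ)^2 < 0) := by
  have key : ((i+m)/2)^2 + ((i+m+1)/2)^2 - i^2 - m^2 ≤ 0 ∧
      (2 ≤ |m - i| → ((i+m)/2)^2 + ((i+m+1)/2)^2 - i^2 - m^2 < 0) := by
    have hd : 2 ≤ |m - i| → 4 ≤ (m-i)^2 := by
      intro h
      rw [← sq_abs]; nlinarith
    rcases Int.even_or_odd' (i+m) with ⟨c, hc | hc⟩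
    · have e1 : (i+m)/2 = c := by omega
      have e2 : (i+m+1)/2 = c := by omega
      rw [e1, e2]
      obtain rfl : m = 2*c - i := by omega
      refine ⟨by nlinarith [sq_nonneg (c - i)], fun h => ?_⟩
      have := hd h
      nlinarith
    · have e1 : (i+m)/2 = c := by omega
      have e2 : (i+m+1)/2 = c+1 := by omega
      rw [e1, e2]
      obtain rfl : m = 2*c + 1 - i := by omega
      refine ⟨?_, fun h => ?_⟩
      · have : 0 ≤ (c - i) * (c - i + 1) := by
          rcases le_or_gt 0 (c - i) with h | h <;> nlinarith
        nlinarith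
      · have := hd h
        nlinarith
  exact_mod_cast key

/-- `p` is a fixed point of the DW interactive Markov chain iff every
class with positive mass has no mass at distance between `2` and `ε` from it. -/
theorem dw_chain_fixed_iff (n ε : ℤ) (hn : 1 ≤ n) (hε : 1 ≤ ε)
    (p : ℤ → ℝ) (hp : IsDist n p) :
    (∀ k ∈ Finset.Icc (1:ℤ) n, stepDW n p ε k = p k) ↔
      (∀ k ∈ Finset.Icc (1:ℤ) n, 0 < p k →
        ∀ m ∈ Finset.Icc (1:ℤ) n, 2 ≤ |m - k| → |m - k| ≤ ε → p m = 0) := by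
  constructor
  · intro h k hk hpk m hm h2 hle
    have H := main_id n ε p (fun k => (k:ℝ)^2) hp
    rw [Finset.sum_eq_zero (fun k hk => by rw [h k hk, sub_self, mul_zero]), mul_zero] at H
    have hA : ∀ i m, 0 ≤ p i * piF p ε i m := by
      intro i m
      refine mul_nonneg (hp.1 i) ?_
      unfold piF
      split_ifs
      · exact hp.1 m
      · exact le_rfl
    have hT : ∀ i m, p i * piF p ε i m * (2 * ((((i+m)/2 : ℤ) : ℝ)^2 + (((i+m+1)/2 : ℤ) : ℝ)^2
        - (i:ℝ)^2 - (m:ℝ)^2)) ≤ 0 := fun i m =>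
      mul_nonpos_of_nonneg_of_nonpos (hA i m) (by linarith [(sqDW_le i m).1])
    have H1 := (Finset.sum_eq_zero_iff_of_nonpos
      (fun i _ => Finset.sum_nonpos fun m _ => hT i m)).1 H.symm k hk
    have H2 := (Finset.sum_eq_zero_iff_of_nonpos (fun m _ => hT k m)).1 H1 m hm
    have hlt := (sqDW_le k m).2 h2
    rw [piF, if_pos (by rwa [abs_sub_comm])] at H2
    rcases mul_eq_zero.1 H2 with H3 | H3
    · exact (mul_eq_zero.1 H3).resolve_left hpk.ne'
    · linarith
  · intro h k hk
    have H := main_id n ε p (fun j => if j = k then 1 else 0) hp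
    simp only [ite_mul, one_mul, zero_mul, Finset.sum_ite_eq', if_pos hk] at H
    rw [Finset.sum_eq_zero] at H
    · linarith
    intro i hi
    refine Finset.sum_eq_zero fun m hm => ?_
    by_cases hd : 2 ≤ |m - i|
    · have : p i * piF p ε i m = 0 := by
        unfold piF
        split_ifs with hle
        · rcases (hp.1 i).eq_or_lt with h0 | h0
          · rw [← h0, zero_mul]
          · rw [h i hi h0 m hm hd (by rwa [abs_sub_comm]), mul_zero]
        · simp
      rw [this, zero_mul]
    · have hd' : |m - i| ≤ 1 := by omega
      rw [abs_le] at hd'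
      have : ((i+m)/2 = i ∧ (i+m+1)/2 = m) ∨ ((i+m)/2 = m ∧ (i+m+1)/2 = i) := by omega
      rcases this with ⟨e1, e2⟩ | ⟨e1, e2⟩ <;> rw [e1, e2] <;> ring
end

section
/- For every opinion distribution p and every k ∈ {1,…,n}, the following discrete master equation holds: (pB^DW(p,ε)) k − p k = Σ_{(i,j) ∈ {1,…,n}², i+j = 2k, 2 ≤ |i−j| ≤ ε} p i · p j + Σ_{(i,j) ∈ {1,…,n}², i+j ∈ {2k−1, 2k+1}, 2 ≤ |i−j| ≤ ε} (1/2) · p i · p j − p k · Σ_{j ∈ {1,…,n}, 2 ≤ |j−k| ≤ ε} p j, where the first two sums run over ordered pairs (i,j). -/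
open Finset
open scoped Classical

/-- weight of the transition of `i` to `j` on meeting `m` -/
noncomputable def dwW (i m j : ℤ) : ℝ :=
  (if j = (i + m) / 2 then 1/2 else 0) + (if j = (i + m + 1) / 2 then 1/2 else 0)

/-- mass of `m` visible from `i` -/
lemma piF_eq_sum (n ε : ℤ) (p : ℤ → ℝ) (hp : IsDist n p) (i x : ℤ) :
    piF p ε i x = ∑ m ∈ Finset.Icc (1:ℤ) n, if m = x then piF p ε i m else 0 := by
  rw [Finset.sum_ite_eq']
  split_ifs with h
  · rfl
  · simp [piF, hp.2.1 x h]

lemma BDWoff_eq_sum (n ε : ℤ) (p : ℤ → ℝ) (hp : IsDist n p) (i j : ℤ) :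
    BDWoff p ε i j = ∑ m ∈ Finset.Icc (1:ℤ) n, piF p ε i m * dwW i m j := by
  unfold BDWoff
  rw [piF_eq_sum n ε p hp i (2*j-i-1), piF_eq_sum n ε p hp i (2*j-i),
    piF_eq_sum n ε p hp i (2*j-i+1), Finset.sum_div, Finset.sum_div,
    ← Finset.sum_add_distrib, ← Finset.sum_add_distrib]
  refine Finset.sum_congr rfl fun m _ => ?_
  unfold dwW
  split_ifs <;> first | (exfalso; omega) | ring

lemma dwW_sum (n k m : ℤ) (hk : k ∈ Finset.Icc (1:ℤ) n) (hm : m ∈ Finset.Icc (1:ℤ) n) :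
    ∑ j ∈ (Finset.Icc (1:ℤ) n).erase k, dwW k m j =
      (if 2 ≤ |m - k| then 1 else 0) + (if |m - k| = 1 then 1/2 else 0) := by
  unfold dwW
  rw [Finset.sum_add_distrib, Finset.sum_ite_eq', Finset.sum_ite_eq']
  simp only [Finset.mem_erase, Finset.mem_Icc] at *
  rcases abs_cases (m - k) with ⟨h, _⟩ | ⟨h, _⟩ <;> rw [h] <;>
  split_ifs <;> first | (exfalso; omega) | norm_num

lemma dw_loss (n ε : ℤ) (p : ℤ → ℝ) (hp : IsDist n p) (k : ℤ)
    (hk : k ∈ Finset.Icc (1:ℤ) n) :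
    ∑ j ∈ (Finset.Icc (1:ℤ) n).erase k, BDWoff p ε k j =
      (∑ j ∈ (Finset.Icc (1:ℤ) n).filter (fun j => 2 ≤ |j - k| ∧ |j - k| ≤ ε), p j)
      + ∑ m ∈ Finset.Icc (1:ℤ) n, (if |m - k| = 1 then piF p ε k m / 2 else 0) := by
  simp_rw [BDWoff_eq_sum n ε p hp]
  rw [Finset.sum_comm, Finset.sum_filter, ← Finset.sum_add_distrib]
  refine Finset.sum_congr rfl fun m hm => ?_
  rw [← Finset.mul_sum, dwW_sum n k m hk hm, piF, abs_sub_comm k m]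
  split_ifs <;> first | (exfalso; omega) | ring

lemma dw_gain_term (ε : ℤ) (p : ℤ → ℝ) (k i m : ℤ) :
    (if i = k then 0 else p i * (piF p ε i m * dwW i m k)) =
      (if i + m = 2 * k ∧ 2 ≤ |i - m| ∧ |i - m| ≤ ε then p i * p m else 0)
      + (if (i + m = 2 * k - 1 ∨ i + m = 2 * k + 1) ∧ 2 ≤ |i - m| ∧ |i - m| ≤ ε
          then (1/2 : ℝ) * (p i * p m) else 0)
      + (if m = k then p k * (if |i - k| = 1 then piF p ε k i / 2 else 0) else 0) := by
  unfold piF dwW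
  rw [abs_sub_comm k i]
  by_cases hmk : m = k
  · subst hmk
    rcases abs_cases (i - m) with ⟨h, _⟩ | ⟨h, _⟩ <;> rw [h] <;>
    split_ifs <;> first | (exfalso; omega) | ring
  · rw [if_neg hmk]
    rcases abs_cases (i - m) with ⟨h, _⟩ | ⟨h, _⟩ <;> rw [h] <;>
    split_ifs <;> first | (exfalso; omega) | ring

/-- the discrete master equation for the DW interactive Markov chain:
gain terms from compromising pairs averaging (approximately) to `k`, and a loss
term for class `k` itself. -/
theorem dw_chain_master_equation (n ε : ℤ) (hn : 1 ≤ n) (hε : 1 ≤ ε)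
    (p : ℤ → ℝ) (hp : IsDist n p) (k : ℤ) (hk : k ∈ Finset.Icc (1:ℤ) n) :
    stepDW n p ε k - p k =
      (∑ ij ∈ ((Finset.Icc (1:ℤ) n) ×ˢ (Finset.Icc (1:ℤ) n)).filter
          (fun ij => ij.1 + ij.2 = 2 * k ∧ 2 ≤ |ij.1 - ij.2| ∧ |ij.1 - ij.2| ≤ ε),
          p ij.1 * p ij.2)
      + (∑ ij ∈ ((Finset.Icc (1:ℤ) n) ×ˢ (Finset.Icc (1:ℤ) n)).filter
          (fun ij => (ij.1 + ij.2 = 2 * k - 1 ∨ ij.1 + ij.2 = 2 * k + 1) ∧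
            2 ≤ |ij.1 - ij.2| ∧ |ij.1 - ij.2| ≤ ε),
          (1/2 : ℝ) * (p ij.1 * p ij.2))
      - p k * ∑ j ∈ (Finset.Icc (1:ℤ) n).filter
          (fun j => 2 ≤ |j - k| ∧ |j - k| ≤ ε), p j := by
  have hstep : stepDW n p ε k - p k =
      (∑ i ∈ Finset.Icc (1:ℤ) n, ∑ m ∈ Finset.Icc (1:ℤ) n,
        (if i = k then 0 else p i * (piF p ε i m * dwW i m k)))
      - p k * ∑ j ∈ (Finset.Icc (1:ℤ) n).erase k, BDWoff p ε k j := by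
    have h1 : ∀ i ∈ Finset.Icc (1:ℤ) n, p i * BDW n p ε i k =
        (∑ m ∈ Finset.Icc (1:ℤ) n,
          (if i = k then 0 else p i * (piF p ε i m * dwW i m k)))
        + (if i = k then
          p k * (1 - ∑ j ∈ (Finset.Icc (1:ℤ) n).erase k, BDWoff p ε k j) else 0) := by
      intro i _
      unfold BDW
      by_cases h : i = k
      · subst h; simp
      · simp only [if_neg h, add_zero]
        rw [BDWoff_eq_sum n ε p hp, Finset.mul_sum]
    unfold stepDW
    rw [Finset.sum_congr rfl h1, Finset.sum_add_distrib, Finset.sum_ite_eq', if_pos hk]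
    ring
  rw [hstep, dw_loss n ε p hp k hk]
  simp_rw [dw_gain_term, Finset.sum_add_distrib, Finset.sum_ite_eq', if_pos hk]
  rw [Finset.sum_filter (s := _ ×ˢ _), Finset.sum_filter (s := _ ×ˢ _),
    Finset.sum_product, Finset.sum_product, ← Finset.mul_sum]
  ring
end

section
/- Let p be an opinion distribution and let I₀ = [i₀..j₀] and I₁ = [i₁..j₁] be integer intervals with i₀ ≤ j₀ and i₁ ≤ j₁. If i₀ ≤ i₁ and j₀ ≤ j₁, then M^bary_{I₀}(p) ≤ M^bary_{I₁}(p). -/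
open Finset
open scoped Classical

/-- The barycenter `M^bary_{[a..b]}(p)`: the mean class of `p` on `[a..b]`,
and the midpoint `(a+b)/2` if `p` has no mass there. -/
noncomputable def Mbary (p : ℤ → ℝ) (a b : ℤ) : ℝ :=
  if (∑ k ∈ Finset.Icc a b, p k) ≠ 0 then
    (∑ k ∈ Finset.Icc a b, (k:ℝ) * p k) / (∑ k ∈ Finset.Icc a b, p k)
  else ((a:ℝ) + (b:ℝ)) / 2

/-- barycenters are monotone under shifting the interval to the right. -/
theorem barycenter_mono (n : ℤ) (hn : 1 ≤ n) (p : ℤ → ℝ) (hp : IsDist n p)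
    (i₀ j₀ i₁ j₁ : ℤ) (h₀ : i₀ ≤ j₀) (h₁ : i₁ ≤ j₁) (hi : i₀ ≤ i₁) (hj : j₀ ≤ j₁) :
    Mbary p i₀ j₀ ≤ Mbary p i₁ j₁ := by
  obtain ⟨hp0, -, -⟩ := hp
  have up : ∀ (S : Finset ℤ) (c : ℤ), (∀ k ∈ S, k ≤ c) →
      ∑ k ∈ S, (k:ℝ) * p k ≤ c * ∑ k ∈ S, p k := by
    intro S c h
    rw [Finset.mul_sum]
    exact Finset.sum_le_sum fun k hk =>
      mul_le_mul_of_nonneg_right (by exact_mod_cast h k hk) (hp0 k)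
  have lo : ∀ (S : Finset ℤ) (c : ℤ), (∀ k ∈ S, c ≤ k) →
      c * ∑ k ∈ S, p k ≤ ∑ k ∈ S, (k:ℝ) * p k := by
    intro S c h
    rw [Finset.mul_sum]
    exact Finset.sum_le_sum fun k hk =>
      mul_le_mul_of_nonneg_right (by exact_mod_cast h k hk) (hp0 k)
  have nn : ∀ S : Finset ℤ, 0 ≤ ∑ k ∈ S, p k := fun S => Finset.sum_nonneg fun k _ => hp0 k
  have e0 : ∀ f : ℤ → ℝ, ∑ k ∈ Icc i₀ j₀, f k
      = ∑ k ∈ Icc i₀ j₀ \ Icc i₁ j₁, f k + ∑ k ∈ Icc i₁ j₀, f k := by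
    intro f
    rw [← Finset.sum_union]
    · congr 1; ext k; simp only [mem_union, mem_sdiff, mem_Icc]; omega
    · rw [Finset.disjoint_left]; intro k; simp only [mem_sdiff, mem_Icc]; omega
  have e1 : ∀ f : ℤ → ℝ, ∑ k ∈ Icc i₁ j₁, f k
      = ∑ k ∈ Icc i₁ j₁ \ Icc i₀ j₀, f k + ∑ k ∈ Icc i₁ j₀, f k := by
    intro f
    rw [← Finset.sum_union]
    · congr 1; ext k; simp only [mem_union, mem_sdiff, mem_Icc]; omega
    · rw [Finset.disjoint_left]; intro k; simp only [mem_sdiff, mem_Icc]; omega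
  have hA1 := up (Icc i₀ j₀ \ Icc i₁ j₁) i₁ (by intro k; simp only [mem_sdiff, mem_Icc]; omega)
  have hA2 := up (Icc i₀ j₀ \ Icc i₁ j₁) j₀ (by intro k; simp only [mem_sdiff, mem_Icc]; omega)
  have hB := lo (Icc i₁ j₁ \ Icc i₀ j₀) j₀ (by intro k; simp only [mem_sdiff, mem_Icc]; omega)
  have hC1 := lo (Icc i₁ j₀) i₁ (by intro k; simp only [mem_Icc]; omega)
  have hC2 := up (Icc i₁ j₀) j₀ (by intro k; simp only [mem_Icc]; omega)
  have nA := nn (Icc i₀ j₀ \ Icc i₁ j₁)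
  have nB := nn (Icc i₁ j₁ \ Icc i₀ j₀)
  have nC := nn (Icc i₁ j₀)
  have r0 : (i₀:ℝ) ≤ j₀ := by exact_mod_cast h₀
  have r1 : (i₁:ℝ) ≤ j₁ := by exact_mod_cast h₁
  have ri : (i₀:ℝ) ≤ i₁ := by exact_mod_cast hi
  have rj : (j₀:ℝ) ≤ j₁ := by exact_mod_cast hj
  unfold Mbary
  rw [e0 p, e1 p, e0 (fun k => (k:ℝ) * p k), e1 (fun k => (k:ℝ) * p k)]
  generalize ∑ k ∈ Icc i₀ j₀ \ Icc i₁ j₁, p k = A0 at *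
  generalize ∑ k ∈ Icc i₁ j₁ \ Icc i₀ j₀, p k = B0 at *
  generalize ∑ k ∈ Icc i₁ j₀, p k = C0 at *
  generalize ∑ k ∈ Icc i₀ j₀ \ Icc i₁ j₁, (k:ℝ) * p k = A1 at *
  generalize ∑ k ∈ Icc i₁ j₁ \ Icc i₀ j₀, (k:ℝ) * p k = B1 at *
  generalize ∑ k ∈ Icc i₁ j₀, (k:ℝ) * p k = C1 at *
  split_ifs with H0 H1 H1
  · have q0 : 0 < A0 + C0 := lt_of_le_of_ne (by linarith) (Ne.symm H0)
    have q1 : 0 < B0 + C0 := lt_of_le_of_ne (by linarith) (Ne.symm H1)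
    rw [div_le_div_iff₀ q0 q1]
    have t1 := mul_le_mul_of_nonneg_right hA1 nC
    have t2 := mul_le_mul_of_nonneg_right hC1 nA
    have t3 := mul_le_mul_of_nonneg_right hA2 nB
    have t4 := mul_le_mul_of_nonneg_right hB nA
    have t5 := mul_le_mul_of_nonneg_right hC2 nB
    have t6 := mul_le_mul_of_nonneg_right hB nC
    linarith
  · have q0 : 0 < A0 + C0 := lt_of_le_of_ne (by linarith) (Ne.symm H0)
    push Not at H1
    have hC : C0 = 0 := by linarith
    subst hC
    rw [div_le_iff₀ q0]
    have : (i₁:ℝ) * A0 ≤ (i₁ + j₁) / 2 * A0 :=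
      mul_le_mul_of_nonneg_right (by linarith) nA
    linarith
  · have q1 : 0 < B0 + C0 := lt_of_le_of_ne (by linarith) (Ne.symm H1)
    push Not at H0
    have hC : C0 = 0 := by linarith
    subst hC
    rw [le_div_iff₀ q1]
    have : ((i₀:ℝ) + j₀) / 2 * B0 ≤ j₀ * B0 :=
      mul_le_mul_of_nonneg_right (by linarith) nB
    linarith
  · linarith
end

section
/- Let p be an opinion distribution and let I₀ = [i₀..j₀] and I₁ = [i₁..j₁] be integer intervals with i₀ ≤ j₀, i₁ ≤ j₁, i₀ ≤ i₁ and j₀ ≤ j₁. Assume moreover that M⁰_{I₀}(p) ≠ 0 or M⁰_{I₁}(p) ≠ 0. Then M^bary_{I₀}(p) < M^bary_{I₁}(p) if and only if there exists m ∈ (I₀ ∪ I₁) \ (I₀ ∩ I₁) with p m > 0. -/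
open Finset
open scoped Classical

/-- strict monotonicity of barycenters holds exactly when some class in
the symmetric difference of the two intervals carries positive mass (assuming not both
intervals are massless). -/
theorem barycenter_strict_mono_iff (n : ℤ) (hn : 1 ≤ n) (p : ℤ → ℝ) (hp : IsDist n p)
    (i₀ j₀ i₁ j₁ : ℤ) (h₀ : i₀ ≤ j₀) (h₁ : i₁ ≤ j₁) (hi : i₀ ≤ i₁) (hj : j₀ ≤ j₁)
    (hmass : (∑ k ∈ Finset.Icc i₀ j₀, p k) ≠ 0 ∨ (∑ k ∈ Finset.Icc i₁ j₁, p k) ≠ 0) :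
    Mbary p i₀ j₀ < Mbary p i₁ j₁ ↔
      ∃ m ∈ (Finset.Icc i₀ j₀ ∪ Finset.Icc i₁ j₁) \ (Finset.Icc i₀ j₀ ∩ Finset.Icc i₁ j₁),
        0 < p m := by
  obtain ⟨hp0, -, -⟩ := hp
  have lo : ∀ (S : Finset ℤ) (l : ℤ), (∀ k ∈ S, l ≤ k) →
      (l:ℝ) * ∑ k ∈ S, p k ≤ ∑ k ∈ S, (k:ℝ) * p k := by
    intro S l h
    rw [Finset.mul_sum]
    exact Finset.sum_le_sum fun k hk =>
      mul_le_mul_of_nonneg_right (by exact_mod_cast h k hk) (hp0 k)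
  have up : ∀ (S : Finset ℤ) (l : ℤ), (∀ k ∈ S, k ≤ l) →
      ∑ k ∈ S, (k:ℝ) * p k ≤ (l:ℝ) * ∑ k ∈ S, p k := by
    intro S l h
    rw [Finset.mul_sum]
    exact Finset.sum_le_sum fun k hk =>
      mul_le_mul_of_nonneg_right (by exact_mod_cast h k hk) (hp0 k)
  have zero : ∀ S : Finset ℤ, ∑ k ∈ S, p k = 0 → ∑ k ∈ S, (k:ℝ) * p k = 0 := by
    intro S h
    rw [Finset.sum_eq_zero_iff_of_nonneg fun k _ => hp0 k] at h
    exact Finset.sum_eq_zero fun k hk => by rw [h k hk, mul_zero]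
  have split0 : ∀ f : ℤ → ℝ, ∑ k ∈ Finset.Icc i₀ j₀, f k =
      ∑ k ∈ Finset.Icc i₀ j₀ \ Finset.Icc i₁ j₁, f k
        + ∑ k ∈ Finset.Icc i₀ j₀ ∩ Finset.Icc i₁ j₁, f k := by
    intro f
    rw [add_comm, Finset.sum_inter_add_sum_sdiff]
  have split1 : ∀ f : ℤ → ℝ, ∑ k ∈ Finset.Icc i₁ j₁, f k =
      ∑ k ∈ Finset.Icc i₀ j₀ ∩ Finset.Icc i₁ j₁, f k
        + ∑ k ∈ Finset.Icc i₁ j₁ \ Finset.Icc i₀ j₀, f k := by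
    intro f
    rw [Finset.inter_comm, Finset.sum_inter_add_sum_sdiff]
  have a1 := up (Finset.Icc i₀ j₀ \ Finset.Icc i₁ j₁) (i₁ - 1) (by
    intro k hk; simp only [Finset.mem_sdiff, Finset.mem_Icc] at hk; omega)
  have b1 := lo (Finset.Icc i₀ j₀ ∩ Finset.Icc i₁ j₁) i₁ (by
    intro k hk; simp only [Finset.mem_inter, Finset.mem_Icc] at hk; omega)
  have b2 := up (Finset.Icc i₀ j₀ ∩ Finset.Icc i₁ j₁) j₀ (by
    intro k hk; simp only [Finset.mem_inter, Finset.mem_Icc] at hk; omega)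
  have c1 := lo (Finset.Icc i₁ j₁ \ Finset.Icc i₀ j₀) (j₀ + 1) (by
    intro k hk; simp only [Finset.mem_sdiff, Finset.mem_Icc] at hk; omega)
  have c2 := lo (Finset.Icc i₁ j₁ \ Finset.Icc i₀ j₀) i₁ (by
    intro k hk; simp only [Finset.mem_sdiff, Finset.mem_Icc] at hk; omega)
  have hex : (∃ m ∈ (Finset.Icc i₀ j₀ ∪ Finset.Icc i₁ j₁) \
      (Finset.Icc i₀ j₀ ∩ Finset.Icc i₁ j₁), 0 < p m) ↔
      (0 < ∑ k ∈ Finset.Icc i₀ j₀ \ Finset.Icc i₁ j₁, p k ∨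
       0 < ∑ k ∈ Finset.Icc i₁ j₁ \ Finset.Icc i₀ j₀, p k) := by
    rw [Finset.sum_pos_iff_of_nonneg fun k _ => hp0 k,
      Finset.sum_pos_iff_of_nonneg fun k _ => hp0 k]
    simp only [Finset.mem_sdiff, Finset.mem_union, Finset.mem_inter]
    constructor
    · rintro ⟨m, hm, hpm⟩
      by_cases h : m ∈ Finset.Icc i₀ j₀
      · exact Or.inl ⟨m, by tauto, hpm⟩
      · exact Or.inr ⟨m, by tauto, hpm⟩
    · rintro (⟨m, hm, hpm⟩ | ⟨m, hm, hpm⟩) <;> exact ⟨m, by tauto, hpm⟩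
  rw [hex]
  unfold Mbary
  simp only [split0, split1] at hmass ⊢
  have zA := zero (Finset.Icc i₀ j₀ \ Finset.Icc i₁ j₁)
  have zB := zero (Finset.Icc i₀ j₀ ∩ Finset.Icc i₁ j₁)
  have zC := zero (Finset.Icc i₁ j₁ \ Finset.Icc i₀ j₀)
  have nA := Finset.sum_nonneg (s := Finset.Icc i₀ j₀ \ Finset.Icc i₁ j₁) fun k _ => hp0 k
  have nB := Finset.sum_nonneg (s := Finset.Icc i₀ j₀ ∩ Finset.Icc i₁ j₁) fun k _ => hp0 k
  have nC := Finset.sum_nonneg (s := Finset.Icc i₁ j₁ \ Finset.Icc i₀ j₀) fun k _ => hp0 k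
  generalize ∑ k ∈ Finset.Icc i₀ j₀ \ Finset.Icc i₁ j₁, p k = A at *
  generalize ∑ k ∈ Finset.Icc i₀ j₀ ∩ Finset.Icc i₁ j₁, p k = B at *
  generalize ∑ k ∈ Finset.Icc i₁ j₁ \ Finset.Icc i₀ j₀, p k = C at *
  generalize ∑ k ∈ Finset.Icc i₀ j₀ \ Finset.Icc i₁ j₁, (k:ℝ) * p k = a at *
  generalize ∑ k ∈ Finset.Icc i₀ j₀ ∩ Finset.Icc i₁ j₁, (k:ℝ) * p k = b at *
  generalize ∑ k ∈ Finset.Icc i₁ j₁ \ Finset.Icc i₀ j₀, (k:ℝ) * p k = c at *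
  push_cast at a1 b1 b2 c1 c2
  have h₀' : (i₀:ℝ) ≤ j₀ := by exact_mod_cast h₀
  have h₁' : (i₁:ℝ) ≤ j₁ := by exact_mod_cast h₁
  by_cases m0 : A + B = 0
  · have hA : A = 0 := by linarith
    have hB : B = 0 := by linarith
    have m1 : B + C ≠ 0 := by tauto
    have hC : 0 < C := lt_of_le_of_ne nC (by rintro rfl; simp [hB] at m1)
    rw [if_neg (not_not.mpr m0), if_pos m1, zB hB, hB, zero_add, zero_add, lt_div_iff₀ hC]
    refine iff_of_true ?_ (Or.inr hC)
    nlinarith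
  by_cases m1 : B + C = 0
  · have hC : C = 0 := by linarith
    have hB : B = 0 := by linarith
    have hA : 0 < A := lt_of_le_of_ne nA (by rintro rfl; simp [hB] at m0)
    rw [if_neg (not_not.mpr m1), if_pos m0, zB hB, hB, add_zero, add_zero, div_lt_iff₀ hA]
    refine iff_of_true ?_ (Or.inl hA)
    nlinarith
  have q0 : 0 < A + B := lt_of_le_of_ne (by linarith) (Ne.symm m0)
  have q1 : 0 < B + C := lt_of_le_of_ne (by linarith) (Ne.symm m1)
  rw [if_pos m0, if_pos m1, div_lt_div_iff₀ q0 q1]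
  have e1 : a * B - b * A ≤ -(A * B) := by
    have := mul_le_mul_of_nonneg_right a1 nB
    have := mul_le_mul_of_nonneg_right b1 nA
    linarith
  have e2 : b * C - c * B ≤ -(B * C) := by
    have := mul_le_mul_of_nonneg_right b2 nC
    have := mul_le_mul_of_nonneg_right c1 nB
    linarith
  have e3 : a * C - c * A ≤ -(A * C) := by
    have := mul_le_mul_of_nonneg_right a1 nC
    have := mul_le_mul_of_nonneg_right c2 nA
    linarith
  have nAB := mul_nonneg nA nB
  have nBC := mul_nonneg nB nC
  have nAC := mul_nonneg nA nC
  constructor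
  · intro h
    by_contra hcon
    push Not at hcon
    have hA : A = 0 := le_antisymm hcon.1 nA
    have hC : C = 0 := le_antisymm hcon.2 nC
    rw [zA hA, zC hC, hA, hC] at h
    simp at h
  · rintro (h | h)
    · have := mul_pos h q1
      linarith
    · have := mul_pos h q0
      linarith
end

section
/- For every opinion distribution p, the ε-local means are monotone: M_1 ≤ M_2 ≤ … ≤ M_n, i.e. for all i, j ∈ {1,…,n} with i ≤ j one has M_i ≤ M_j. -/
open Finset
open scoped Classical

/-- The `ε`-local mean `M_i = M^bary_{[i-ε..i+ε]}(p)`. -/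
noncomputable def locM (p : ℤ → ℝ) (ε i : ℤ) : ℝ := Mbary p (i - ε) (i + ε)

/-- The Hegselmann–Krause transition matrix `B^HK(p,ε)` on `{1,…,n} × {1,…,n}`. -/
noncomputable def BHK (p : ℤ → ℝ) (ε i j : ℤ) : ℝ :=
  if (j:ℝ) = locM p ε i then 1
  else if j = ⌊locM p ε i⌋ then (⌈locM p ε i⌉ : ℝ) - locM p ε i
  else if j = ⌈locM p ε i⌉ then locM p ε i - (⌊locM p ε i⌋ : ℝ)
  else 0

/-- One step of the HK interactive Markov chain: `(pB^HK(p,ε)) k`. -/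
noncomputable def stepHK (n : ℤ) (p : ℤ → ℝ) (ε : ℤ) (k : ℤ) : ℝ :=
  ∑ i ∈ Finset.Icc (1:ℤ) n, p i * BHK p ε i k

/-- One-step monotonicity of local means. -/
lemma locM_step (p : ℤ → ℝ) (hp : ∀ m, 0 ≤ p m) (ε : ℤ) (hε : 1 ≤ ε) (i : ℤ) :
    locM p ε i ≤ locM p ε (i + 1) := by
  have hA : Finset.Icc (i - ε) (i + ε) = insert (i - ε) (Finset.Icc (i + 1 - ε) (i + ε)) := by
    ext k; simp only [Finset.mem_Icc, Finset.mem_insert]; omega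
  have hB : Finset.Icc (i + 1 - ε) (i + 1 + ε)
      = insert (i + 1 + ε) (Finset.Icc (i + 1 - ε) (i + ε)) := by
    ext k; simp only [Finset.mem_Icc, Finset.mem_insert]; omega
  have hA' : (i - ε) ∉ Finset.Icc (i + 1 - ε) (i + ε) := by simp only [Finset.mem_Icc]; omega
  have hB' : (i + 1 + ε) ∉ Finset.Icc (i + 1 - ε) (i + ε) := by
    simp only [Finset.mem_Icc]; omega
  have hm : 0 ≤ ∑ k ∈ Finset.Icc (i + 1 - ε) (i + ε), p k := Finset.sum_nonneg fun k _ => hp k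
  have hlo : ((i : ℝ) + 1 - ε) * ∑ k ∈ Finset.Icc (i + 1 - ε) (i + ε), p k
      ≤ ∑ k ∈ Finset.Icc (i + 1 - ε) (i + ε), (k : ℝ) * p k := by
    rw [Finset.mul_sum]
    refine Finset.sum_le_sum fun k hk => mul_le_mul_of_nonneg_right ?_ (hp k)
    exact_mod_cast (Finset.mem_Icc.1 hk).1
  have hhi : ∑ k ∈ Finset.Icc (i + 1 - ε) (i + ε), (k : ℝ) * p k
      ≤ ((i : ℝ) + ε) * ∑ k ∈ Finset.Icc (i + 1 - ε) (i + ε), p k := by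
    rw [Finset.mul_sum]
    refine Finset.sum_le_sum fun k hk => mul_le_mul_of_nonneg_right ?_ (hp k)
    exact_mod_cast (Finset.mem_Icc.1 hk).2
  have hx := hp (i - ε)
  have hy := hp (i + 1 + ε)
  have he : (1 : ℝ) ≤ ε := by exact_mod_cast hε
  unfold locM Mbary
  rw [hA, hB, Finset.sum_insert hA', Finset.sum_insert hA', Finset.sum_insert hB',
    Finset.sum_insert hB']
  generalize (∑ k ∈ Finset.Icc (i + 1 - ε) (i + ε), p k) = m at *
  generalize (∑ k ∈ Finset.Icc (i + 1 - ε) (i + ε), (k : ℝ) * p k) = s at *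
  generalize p (i - ε) = x at *
  generalize p (i + 1 + ε) = y at *
  push_cast
  generalize (i : ℝ) = a at *
  generalize (ε : ℝ) = e at *
  split_ifs with h1 h2 h2
  · have h1' : 0 < x + m := lt_of_le_of_ne (by linarith) (Ne.symm h1)
    have h2' : 0 < y + m := lt_of_le_of_ne (by linarith) (Ne.symm h2)
    rw [div_le_div_iff₀ h1' h2']
    nlinarith [mul_nonneg hx (by linarith : 0 ≤ s - (a - e) * m),
      mul_nonneg hy (by linarith : 0 ≤ (a + 1 + e) * m - s),
      mul_nonneg (mul_nonneg hx hy) (by linarith : 0 ≤ 2 * e + 1)]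
  · have h1' : 0 < x + m := lt_of_le_of_ne (by linarith) (Ne.symm h1)
    have hm0 : m = 0 := by linarith [not_not.1 h2]
    subst hm0
    rw [div_le_iff₀ h1']
    nlinarith
  · have h2' : 0 < y + m := lt_of_le_of_ne (by linarith) (Ne.symm h2)
    have hm0 : m = 0 := by linarith [not_not.1 h1]
    subst hm0
    rw [le_div_iff₀ h2']
    nlinarith
  · linarith

/-- the `ε`-local means are monotone: `M_1 ≤ M_2 ≤ … ≤ M_n`. -/
theorem locM_mono (n ε : ℤ) (hn : 1 ≤ n) (hε : 1 ≤ ε) (p : ℤ → ℝ) (hp : IsDist n p) :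
    ∀ i ∈ Finset.Icc (1:ℤ) n, ∀ j ∈ Finset.Icc (1:ℤ) n, i ≤ j →
      locM p ε i ≤ locM p ε j := by
  intro i _ j _ hij
  exact monotone_int_of_le_succ (f := locM p ε) (fun k => locM_step p hp.1 ε hε k) hij
end

section
/- Let p be a fixed point of the HK interactive Markov chain and let i ∈ {1,…,n} with p i > 0. Then i − 1 < M_i < i + 1. -/
open Finset
open scoped Classical

lemma le_Mbary_iff (p : ℤ → ℝ) (a b : ℤ) (h : 0 < ∑ k ∈ Finset.Icc a b, p k) (x : ℝ) :
    x ≤ Mbary p a b ↔ 0 ≤ ∑ k ∈ Finset.Icc a b, ((k:ℝ) - x) * p k := by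
  unfold Mbary
  rw [if_pos h.ne', le_div_iff₀ h]
  simp only [sub_mul, Finset.sum_sub_distrib, ← Finset.mul_sum]
  exact sub_nonneg.symm

lemma Mbary_le_iff (p : ℤ → ℝ) (a b : ℤ) (h : 0 < ∑ k ∈ Finset.Icc a b, p k) (x : ℝ) :
    Mbary p a b ≤ x ↔ ∑ k ∈ Finset.Icc a b, ((k:ℝ) - x) * p k ≤ 0 := by
  unfold Mbary
  rw [if_pos h.ne', div_le_iff₀ h]
  simp only [sub_mul, Finset.sum_sub_distrib, ← Finset.mul_sum]
  exact sub_nonpos.symm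

lemma Mbary_ge_of (p : ℤ → ℝ) (hp : ∀ m, 0 ≤ p m) (a b : ℤ)
    (h : 0 < ∑ k ∈ Finset.Icc a b, p k) (x : ℝ)
    (hx : ∀ k ∈ Finset.Icc a b, p k ≠ 0 → x ≤ k) : x ≤ Mbary p a b := by
  rw [le_Mbary_iff p a b h]
  refine Finset.sum_nonneg fun k hk => ?_
  by_cases h0 : p k = 0
  · simp [h0]
  · exact mul_nonneg (sub_nonneg.2 (hx k hk h0)) (hp k)

lemma Mbary_le_of (p : ℤ → ℝ) (hp : ∀ m, 0 ≤ p m) (a b : ℤ)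
    (h : 0 < ∑ k ∈ Finset.Icc a b, p k) (x : ℝ)
    (hx : ∀ k ∈ Finset.Icc a b, p k ≠ 0 → (k:ℝ) ≤ x) : Mbary p a b ≤ x := by
  rw [Mbary_le_iff p a b h]
  refine Finset.sum_nonpos fun k hk => ?_
  by_cases h0 : p k = 0
  · simp [h0]
  · exact mul_nonpos_of_nonpos_of_nonneg (sub_nonpos.2 (hx k hk h0)) (hp k)

lemma Mbary_mono (p : ℤ → ℝ) (hp : ∀ m, 0 ≤ p m) (a b a' b' : ℤ) (ha : a ≤ a') (hb : b ≤ b')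
    (h : 0 < ∑ k ∈ Finset.Icc a b, p k) (h' : 0 < ∑ k ∈ Finset.Icc a' b', p k) :
    Mbary p a b ≤ Mbary p a' b' := by
  have s1 : Finset.Icc a b ⊆ Finset.Icc a b' := Finset.Icc_subset_Icc le_rfl hb
  have s2 : Finset.Icc a' b' ⊆ Finset.Icc a b' := Finset.Icc_subset_Icc ha le_rfl
  have hm : 0 < ∑ k ∈ Finset.Icc a b', p k :=
    h.trans_le (Finset.sum_le_sum_of_subset_of_nonneg s1 fun k _ _ => hp k)
  have e1 : Mbary p a b ≤ b := by
    refine Mbary_le_of p hp a b h _ fun k hk _ => ?_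
    exact_mod_cast (Finset.mem_Icc.1 hk).2
  have e2 : (a' : ℝ) ≤ Mbary p a' b' := by
    refine Mbary_ge_of p hp a' b' h' _ fun k hk _ => ?_
    exact_mod_cast (Finset.mem_Icc.1 hk).1
  refine le_trans (b := Mbary p a b') ?_ ?_
  · rw [le_Mbary_iff p a b' hm]
    refine le_trans ((le_Mbary_iff p a b h _).1 le_rfl)
      (Finset.sum_le_sum_of_subset_of_nonneg s1 fun k hk hk' => ?_)
    refine mul_nonneg (sub_nonneg.2 (e1.trans ?_)) (hp k)
    simp only [Finset.mem_Icc] at hk hk'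
    have : b ≤ k := by omega
    exact_mod_cast this
  · rw [Mbary_le_iff p a b' hm]
    have h3 := (Mbary_le_iff p a' b' h' _).1 le_rfl
    rw [← Finset.sum_sdiff s2]
    refine add_nonpos (Finset.sum_nonpos fun k hk => ?_) h3
    refine mul_nonpos_of_nonpos_of_nonneg (sub_nonpos.2 (le_trans ?_ e2)) (hp k)
    simp only [Finset.mem_sdiff, Finset.mem_Icc] at hk
    have : k ≤ a' := by omega
    exact_mod_cast this

lemma BHK_nonneg (p : ℤ → ℝ) (ε i j : ℤ) : 0 ≤ BHK p ε i j := by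
  unfold BHK
  split_ifs
  · exact zero_le_one
  · exact sub_nonneg.2 (Int.le_ceil _)
  · exact sub_nonneg.2 (Int.floor_le _)
  · exact le_rfl

lemma BHK_row (p : ℤ → ℝ) (ε i a b : ℤ) (ha : (a:ℝ) ≤ locM p ε i) (hb : locM p ε i ≤ b) :
    ∑ k ∈ Finset.Icc a b, BHK p ε i k = 1 := by
  unfold BHK
  generalize locM p ε i = M at *
  have hfa : a ≤ ⌊M⌋ := Int.le_floor.2 ha
  have hcb : ⌈M⌉ ≤ b := Int.ceil_le.2 hb
  have hfc : ⌊M⌋ ≤ ⌈M⌉ := Int.floor_le_ceil M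
  by_cases hM : (⌊M⌋ : ℝ) = M
  · rw [Finset.sum_eq_single ⌊M⌋]
    · simp [hM]
    · intro k _ hk
      have hc : ⌈M⌉ = ⌊M⌋ := by conv_lhs => rw [← hM, Int.ceil_intCast]
      have : (k:ℝ) ≠ M := by
        rw [← hM]; exact_mod_cast hk
      simp [this, hk, hc]
    · intro h; exact absurd (Finset.mem_Icc.2 ⟨hfa, by omega⟩) h
  · have hne : ∀ k : ℤ, (k:ℝ) ≠ M := by
      intro k hk; apply hM; rw [← hk, Int.floor_intCast]
    have hlt : ⌊M⌋ < ⌈M⌉ := by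
      have h1 : (⌊M⌋:ℝ) < M := lt_of_le_of_ne (Int.floor_le M) hM
      exact Int.lt_ceil.2 h1
    have hc1 : (⌈M⌉ : ℝ) = ⌊M⌋ + 1 := by
      have : ⌈M⌉ ≤ ⌊M⌋ + 1 := Int.ceil_le_floor_add_one M
      have : ⌈M⌉ = ⌊M⌋ + 1 := by omega
      exact_mod_cast this
    have hs : ({⌊M⌋, ⌈M⌉} : Finset ℤ) ⊆ Finset.Icc a b := by
      intro k hk
      simp only [Finset.mem_insert, Finset.mem_singleton] at hk
      rw [Finset.mem_Icc]; omega
    rw [← Finset.sum_subset hs, Finset.sum_pair hlt.ne]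
    · rw [if_neg (hne _), if_pos rfl, if_neg (hne _), if_neg hlt.ne', if_pos rfl]
      linarith
    · intro k _ hk
      simp only [Finset.mem_insert, Finset.mem_singleton, not_or] at hk
      simp [hne, hk.1, hk.2]

/-- No set of classes `J` can flow into `[a..b] ⊆ [1..n]` if it is strictly heavier. -/
lemma flow_le (n ε : ℤ) (p : ℤ → ℝ) (hp : ∀ m, 0 ≤ p m)
    (hfix : ∀ k ∈ Finset.Icc (1:ℤ) n, stepHK n p ε k = p k)
    (a b : ℤ) (ha : 1 ≤ a) (hb : b ≤ n) (J : Finset ℤ) (hJ : J ⊆ Finset.Icc 1 n)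
    (h : ∀ j ∈ J, p j ≠ 0 → (a:ℝ) ≤ locM p ε j ∧ locM p ε j ≤ b) :
    ∑ j ∈ J, p j ≤ ∑ k ∈ Finset.Icc a b, p k := by
  have e : ∑ k ∈ Finset.Icc a b, p k
      = ∑ j ∈ Finset.Icc 1 n, p j * ∑ k ∈ Finset.Icc a b, BHK p ε j k := by
    simp only [Finset.mul_sum]
    rw [Finset.sum_comm]
    refine Finset.sum_congr rfl fun k hk => ?_
    rw [← hfix k (Finset.Icc_subset_Icc ha hb hk), stepHK]
  rw [e]
  refine le_trans (le_of_eq (Finset.sum_congr rfl fun j hj => ?_))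
    (Finset.sum_le_sum_of_subset_of_nonneg hJ fun j _ _ =>
      mul_nonneg (hp j) (Finset.sum_nonneg fun k _ => BHK_nonneg p ε j k))
  by_cases h0 : p j = 0
  · simp [h0]
  · rw [BHK_row p ε j a b (h j hj h0).1 (h j hj h0).2, mul_one]

/-- in a fixed point of the HK interactive Markov chain, every class
with positive mass has its `ε`-local mean strictly within distance `1`. -/
theorem hk_chain_fixed_locM_close (n ε : ℤ) (hn : 1 ≤ n) (hε : 1 ≤ ε)
    (p : ℤ → ℝ) (hp : IsDist n p)
    (hfix : ∀ k ∈ Finset.Icc (1:ℤ) n, stepHK n p ε k = p k)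
    (i : ℤ) (hi : i ∈ Finset.Icc (1:ℤ) n) (hpi : 0 < p i) :
    (i:ℝ) - 1 < locM p ε i ∧ locM p ε i < (i:ℝ) + 1 := by
  obtain ⟨hp0, hpout, -⟩ := hp
  have hi' := Finset.mem_Icc.1 hi
  have hmass : ∀ j, p j ≠ 0 → 0 < ∑ k ∈ Finset.Icc (j - ε) (j + ε), p k := fun j hj =>
    Finset.sum_pos' (fun k _ => hp0 k)
      ⟨j, Finset.mem_Icc.2 ⟨by omega, by omega⟩, lt_of_le_of_ne (hp0 j) hj.symm⟩
  have hin : ∀ k, p k ≠ 0 → 1 ≤ k ∧ k ≤ n := fun k hk => by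
    by_contra hc
    exact hk (hpout k (fun h => hc (Finset.mem_Icc.1 h)))
  have hlo : ∀ j, p j ≠ 0 → ((1:ℤ):ℝ) ≤ locM p ε j := fun j hj =>
    Mbary_ge_of p hp0 _ _ (hmass j hj) _ fun k _ hk => by exact_mod_cast (hin k hk).1
  have hhi : ∀ j, p j ≠ 0 → locM p ε j ≤ n := fun j hj =>
    Mbary_le_of p hp0 _ _ (hmass j hj) _ fun k _ hk => by exact_mod_cast (hin k hk).2
  have hmono : ∀ j l, j ≤ l → p j ≠ 0 → p l ≠ 0 → locM p ε j ≤ locM p ε l :=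
    fun j l hjl hj hl =>
      Mbary_mono p hp0 _ _ _ _ (by omega) (by omega) (hmass j hj) (hmass l hl)
  constructor
  · by_contra! hc
    have := flow_le n ε p hp0 hfix 1 (i - 1) le_rfl (by omega)
      (insert i (Finset.Icc 1 (i - 1))) (by
        intro k hk
        simp only [Finset.mem_insert, Finset.mem_Icc] at hk ⊢
        omega) (by
        intro j hj h0
        refine ⟨hlo j h0, (hmono j i ?_ h0 hpi.ne').trans (by push_cast; exact hc)⟩
        simp only [Finset.mem_insert, Finset.mem_Icc] at hj
        omega)
    rw [Finset.sum_insert (by simp)] at this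
    linarith
  · by_contra! hc
    have := flow_le n ε p hp0 hfix (i + 1) n (by omega) le_rfl
      (insert i (Finset.Icc (i + 1) n)) (by
        intro k hk
        simp only [Finset.mem_insert, Finset.mem_Icc] at hk ⊢
        omega) (by
        intro j hj h0
        refine ⟨le_trans (by push_cast; exact hc) (hmono i j ?_ hpi.ne' h0), hhi j h0⟩
        simp only [Finset.mem_insert, Finset.mem_Icc] at hj
        omega)
    rw [Finset.sum_insert (by simp)] at this
    linarith
end

section
/- Let p be a fixed point of the HK interactive Markov chain and let i ∈ {1,…,n} with p i > 0 and M_i > i. Then i < n, p (i+1) > 0, and i < M_i ≤ M_{i+1} < i + 1. -/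
open Finset
open scoped Classical

lemma Mbary_step (p : ℤ → ℝ) (hp : ∀ m, 0 ≤ p m) (a b : ℤ) (hab : a ≤ b) :
    Mbary p a b ≤ Mbary p (a+1) (b+1) := by
  have e1 : ∀ f : ℤ → ℝ, ∑ k ∈ Finset.Icc a b, f k = f a + ∑ k ∈ Finset.Icc (a+1) b, f k := by
    intro f
    have : Finset.Icc a b = insert a (Finset.Icc (a+1) b) := by
      ext x; simp only [Finset.mem_Icc, Finset.mem_insert]; omega
    rw [this, Finset.sum_insert (by simp)]
  have e2 : ∀ f : ℤ → ℝ, ∑ k ∈ Finset.Icc (a+1) (b+1), f k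
      = f (b+1) + ∑ k ∈ Finset.Icc (a+1) b, f k := by
    intro f
    have : Finset.Icc (a+1) (b+1) = insert (b+1) (Finset.Icc (a+1) b) := by
      ext x; simp only [Finset.mem_Icc, Finset.mem_insert]; omega
    rw [this, Finset.sum_insert (by simp)]
  unfold Mbary
  rw [e1, e1, e2, e2]
  have hS : 0 ≤ ∑ k ∈ Finset.Icc (a+1) b, p k := Finset.sum_nonneg fun k _ => hp k
  have hT1 : (a:ℝ) * ∑ k ∈ Finset.Icc (a+1) b, p k ≤ ∑ k ∈ Finset.Icc (a+1) b, (k:ℝ) * p k := by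
    rw [Finset.mul_sum]
    refine Finset.sum_le_sum fun k hk => mul_le_mul_of_nonneg_right ?_ (hp k)
    rw [Finset.mem_Icc] at hk
    exact_mod_cast (by omega : a ≤ k)
  have hT2 : ∑ k ∈ Finset.Icc (a+1) b, (k:ℝ) * p k ≤ ((b:ℝ)+1) * ∑ k ∈ Finset.Icc (a+1) b, p k := by
    rw [Finset.mul_sum]
    refine Finset.sum_le_sum fun k hk => mul_le_mul_of_nonneg_right ?_ (hp k)
    rw [Finset.mem_Icc] at hk
    exact_mod_cast (by omega : k ≤ b + 1)
  generalize (∑ k ∈ Finset.Icc (a+1) b, p k) = S at *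
  generalize (∑ k ∈ Finset.Icc (a+1) b, (k:ℝ) * p k) = T at *
  have hx := hp a
  have hy := hp (b+1)
  generalize p a = x at *
  generalize p (b+1) = y at *
  have hab' : (a:ℝ) ≤ b := by exact_mod_cast hab
  push_cast
  split_ifs with h1 h2 h2
  · have h1' : 0 < x + S := lt_of_le_of_ne (by positivity) (Ne.symm h1)
    have h2' : 0 < y + S := lt_of_le_of_ne (by positivity) (Ne.symm h2)
    rw [div_le_div_iff₀ h1' h2']
    have := mul_nonneg hx (sub_nonneg.2 hT1)
    have := mul_nonneg hy (sub_nonneg.2 hT2)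
    have := mul_nonneg (mul_nonneg hx hy) (by linarith : (0:ℝ) ≤ b + 1 - a)
    nlinarith
  · push Not at h2
    have hS0 : S = 0 := by linarith
    subst hS0
    have hT0 : T = 0 := by linarith
    subst hT0
    simp only [add_zero] at *
    rw [mul_div_cancel_right₀ _ h1]
    linarith
  · push Not at h1
    have hS0 : S = 0 := by linarith
    subst hS0
    have hT0 : T = 0 := by linarith
    subst hT0
    simp only [add_zero] at *
    rw [mul_div_cancel_right₀ _ h2]
    linarith
  · linarith

lemma locM_mono_s13 (p : ℤ → ℝ) (hp : ∀ m, 0 ≤ p m) (ε : ℤ) (hε : 1 ≤ ε) : Monotone (locM p ε) := by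
  apply monotone_int_of_le_succ
  intro i
  unfold locM
  have := Mbary_step p hp (i - ε) (i + ε) (by omega)
  rwa [show i - ε + 1 = i + 1 - ε by ring, show i + ε + 1 = i + 1 + ε by ring] at this

lemma BHK_eq (p : ℤ → ℝ) (ε i j : ℤ) : BHK p ε i j =
    (if j = ⌊locM p ε i⌋ then 1 - Int.fract (locM p ε i) else 0) +
    (if j = ⌊locM p ε i⌋ + 1 then Int.fract (locM p ε i) else 0) := by
  unfold BHK
  generalize locM p ε i = M
  by_cases hM : Int.fract M = 0
  · have hc : ((⌊M⌋:ℤ):ℝ) = M := by have := Int.floor_add_fract M; linarith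
    have hce : ⌈M⌉ = ⌊M⌋ := by
      rw [← hc]; simp
    by_cases hj : j = ⌊M⌋
    · subst hj; simp [hc, hM]
    · have : (j:ℝ) ≠ M := by
        intro h; apply hj; rw [← h]; simp
      simp [hj, this, hM, hce]
  · have hce : ⌈M⌉ = ⌊M⌋ + 1 := by
      rw [Int.ceil_eq_iff]
      have h0 := Int.floor_add_fract M
      have h1 := Int.fract_lt_one M
      have h2 := lt_of_le_of_ne (Int.fract_nonneg M) (Ne.symm hM)
      push_cast
      constructor <;> linarith
    have hne : (j:ℝ) ≠ M := by
      intro h; apply hM; rw [← h]; simp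
    have h0 := Int.floor_add_fract M
    rw [if_neg hne, hce]
    push_cast
    by_cases hj : j = ⌊M⌋
    · subst hj; simp; linarith
    · by_cases hj2 : j = ⌊M⌋ + 1
      · subst hj2; simp
      · simp [hj, hj2]

lemma sum_BHK_le (p : ℤ → ℝ) (ε i : ℤ) (s : Finset ℤ) : ∑ j ∈ s, BHK p ε i j ≤ 1 := by
  simp only [BHK_eq, Finset.sum_add_distrib, Finset.sum_ite_eq']
  have h1 := Int.fract_lt_one (locM p ε i)
  have h2 := Int.fract_nonneg (locM p ε i)
  split_ifs <;> linarith

/-- If the local mean is at least `k+1`, nothing goes to classes `≤ k`. -/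
lemma BHK_zero (p : ℤ → ℝ) (ε j k : ℤ) (h : ((k + 1 : ℤ):ℝ) ≤ locM p ε j) : BHK p ε j k = 0 := by
  rw [BHK_eq]
  have := Int.le_floor.2 h
  rw [if_neg (by omega), if_neg (by omega), add_zero]

lemma sum_BHK_lt (p : ℤ → ℝ) (ε i : ℤ) (h : (i:ℝ) < locM p ε i) :
    ∑ k ∈ Finset.Icc 1 i, BHK p ε i k < 1 := by
  simp only [BHK_eq, Finset.sum_add_distrib, Finset.sum_ite_eq', Finset.mem_Icc]
  have h1 := Int.fract_lt_one (locM p ε i)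
  have h2 := Int.fract_nonneg (locM p ε i)
  have h3 : i ≤ ⌊locM p ε i⌋ := Int.le_floor.2 h.le
  have h0 := Int.floor_add_fract (locM p ε i)
  rw [if_neg (by omega : ¬ (1 ≤ ⌊locM p ε i⌋ + 1 ∧ ⌊locM p ε i⌋ + 1 ≤ i))]
  split_ifs with h4
  · have : ⌊locM p ε i⌋ = i := by omega
    rw [this] at h0
    linarith
  · norm_num

/-- Mass flow through the cut between `i` and `i+1`: some mass has to come back. -/
lemma flow_contra (n ε : ℤ) (p : ℤ → ℝ) (hp : IsDist n p)
    (hfix : ∀ k ∈ Finset.Icc (1:ℤ) n, stepHK n p ε k = p k)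
    (i : ℤ) (hi : i ∈ Finset.Icc (1:ℤ) n) (hpi : 0 < p i)
    (hMi : (i:ℝ) < locM p ε i)
    (h : ∀ j, i + 1 ≤ j → j ≤ n → ((i + 1 : ℤ):ℝ) ≤ locM p ε j) : False := by
  rw [Finset.mem_Icc] at hi
  have e1 : ∑ k ∈ Finset.Icc 1 i, p k
      = ∑ j ∈ Finset.Icc 1 n, p j * ∑ k ∈ Finset.Icc 1 i, BHK p ε j k := by
    simp only [Finset.mul_sum]
    rw [Finset.sum_comm]
    refine Finset.sum_congr rfl fun k hk => ?_
    rw [Finset.mem_Icc] at hk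
    exact (hfix k (Finset.mem_Icc.2 ⟨hk.1, by omega⟩)).symm
  have e2 : ∑ j ∈ Finset.Icc 1 n, p j * ∑ k ∈ Finset.Icc 1 i, BHK p ε j k
      = ∑ j ∈ Finset.Icc 1 i, p j * ∑ k ∈ Finset.Icc 1 i, BHK p ε j k := by
    symm
    apply Finset.sum_subset
    · intro x hx; rw [Finset.mem_Icc] at *; omega
    · intro j hj hj'
      rw [Finset.mem_Icc] at hj hj'
      rw [Finset.sum_eq_zero, mul_zero]
      intro k hk
      rw [Finset.mem_Icc] at hk
      apply BHK_zero
      refine le_trans ?_ (h j (by omega) hj.2)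
      exact_mod_cast (by omega : k + 1 ≤ i + 1)
  have e3 : ∑ j ∈ Finset.Icc 1 i, p j * ∑ k ∈ Finset.Icc 1 i, BHK p ε j k
      < ∑ j ∈ Finset.Icc 1 i, p j := by
    apply Finset.sum_lt_sum
    · intro j _
      exact mul_le_of_le_one_right (hp.1 j) (sum_BHK_le p ε j _)
    · exact ⟨i, Finset.mem_Icc.2 ⟨hi.1, le_rfl⟩, mul_lt_of_lt_one_right hpi (sum_BHK_lt p ε i hMi)⟩
  linarith

/-- in a fixed point of the HK interactive Markov chain, if `p i > 0`
and `M_i > i` then `i < n`, `p (i+1) > 0` and `i < M_i ≤ M_{i+1} < i+1`. -/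
theorem hk_chain_fixed_right_pair (n ε : ℤ) (hn : 1 ≤ n) (hε : 1 ≤ ε)
    (p : ℤ → ℝ) (hp : IsDist n p)
    (hfix : ∀ k ∈ Finset.Icc (1:ℤ) n, stepHK n p ε k = p k)
    (i : ℤ) (hi : i ∈ Finset.Icc (1:ℤ) n) (hpi : 0 < p i)
    (hMi : (i:ℝ) < locM p ε i) :
    i < n ∧ 0 < p (i+1) ∧ (i:ℝ) < locM p ε i ∧ locM p ε i ≤ locM p ε (i+1) ∧
      locM p ε (i+1) < (i:ℝ) + 1 := by
  have mono := locM_mono_s13 p hp.1 ε hε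
  have hin : i < n := by
    by_contra hcon
    exact flow_contra n ε p hp hfix i hi hpi hMi (fun j _ _ => by omega)
  have hlt : locM p ε (i+1) < (i:ℝ) + 1 := by
    by_contra hcon
    refine flow_contra n ε p hp hfix i hi hpi hMi (fun j hj _ => ?_)
    have := mono hj
    push_cast
    linarith
  have hle : locM p ε i ≤ locM p ε (i+1) := mono (by omega)
  refine ⟨hin, ?_, hMi, hle, hlt⟩
  have hi' := Finset.mem_Icc.1 hi
  rw [← hfix (i+1) (Finset.mem_Icc.2 ⟨by omega, by omega⟩)]
  have hfl : ⌊locM p ε i⌋ = i := Int.floor_eq_iff.2 ⟨hMi.le, by linarith⟩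
  have hB : 0 < BHK p ε i (i+1) := by
    rw [BHK_eq, hfl, if_neg (by omega), if_pos rfl, Int.fract, hfl]
    linarith
  exact Finset.sum_pos' (fun j _ => mul_nonneg (hp.1 j) (BHK_nonneg p ε j _))
    ⟨i, hi, mul_pos hpi hB⟩
end
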